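/- Let n ≥ 2, let K be a field, let D_n be the graph obtained from the ladder graph A_n by adjoining two new vertices x_{n+1}, y_{n+1} together with the edges {y_n,y_{n+1}} and {x_1,x_{n+1}}, and let S = K[V(D_n)]. Then pdim(S/I(D_n)) = 2n − ⌈(n+1)/2⌉ + 1 if n ≡ 0 or 1 (mod 4), and pdim(S/I(D_n)) = 2n − ⌈(n+1)/2⌉ + 2 if n ≡ 2 or 3 (mod 4). -/

import Mathlib

open MvPolynomial

/-- The edge ideal of a simple graph `G`, inside `K[x_v : v ∈ V]`. -/
noncomputable def edgeIdeal (K : Type*) [Field K] {V : Type*} (G : SimpleGraph V) :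
    Ideal (MvPolynomial V K) :=
  Ideal.span {m | ∃ i j : V, G.Adj i j ∧ m = X i * X j}

/-- The graded maximal ideal of `K[x_v : v ∈ V]`. -/
noncomputable def maxIdeal (K : Type*) [Field K] (V : Type*) : Ideal (MvPolynomial V K) :=
  Ideal.span (Set.range (X : V → MvPolynomial V K))

/-- depth of `S/I` over `S = K[x_v]`: the supremum of lengths of regular sequences on `S/I`
consisting of elements of the graded maximal ideal. -/
noncomputable def depthQuot {K : Type*} [Field K] {V : Type*} (I : Ideal (MvPolynomial V K)) : ℕ :=
  sSup {n : ℕ | ∃ rs : List (MvPolynomial V K), rs.length = n ∧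
    (∀ r ∈ rs, r ∈ maxIdeal K V) ∧
    RingTheory.Sequence.IsRegular (MvPolynomial V K ⧸ I) rs}

/-- The Stanley space `u·K[Z]` inside `S/I`, as a `K`-subspace. -/
noncomputable def stanleySpace {K : Type*} [Field K] {V : Type*}
    (I : Ideal (MvPolynomial V K)) (u : V →₀ ℕ) (Z : Finset V) :
    Submodule K (MvPolynomial V K ⧸ I) :=
  Submodule.span K
    {x | ∃ a : V →₀ ℕ, a.support ⊆ Z ∧ x = Ideal.Quotient.mk I (monomial (u + a) (1 : K))}

/-- A Stanley decomposition of `S/I`: a finite family of Stanley spaces `u_j K[Z_j]`,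
each of which is a free `K[Z_j]`-module (expressed by linear independence of the monomial
spanning set), whose internal direct sum is all of `S/I`. -/
structure StanleyDecomposition {K : Type*} [Field K] {V : Type*}
    (I : Ideal (MvPolynomial V K)) : Type _ where
  m : ℕ
  u : Fin m → (V →₀ ℕ)
  Z : Fin m → Finset V
  free : ∀ j : Fin m, LinearIndependent K
    (fun a : {a : V →₀ ℕ // a.support ⊆ Z j} =>
      Ideal.Quotient.mk I (monomial (u j + (a : V →₀ ℕ)) (1 : K)))
  internal : DirectSum.IsInternal (fun j : Fin m => stanleySpace I (u j) (Z j))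

/-- The Stanley depth of `S/I`. -/
noncomputable def sdepthQuot {K : Type*} [Field K] {V : Type*}
    (I : Ideal (MvPolynomial V K)) : ℕ :=
  sSup {n : ℕ | ∃ D : StanleyDecomposition I, ∀ j, n ≤ (D.Z j).card}

/-- `pdimLE R n M`: the `R`-module `M` has projective dimension at most `n`,
i.e. it admits a projective resolution of length `n`. -/
def pdimLE (R : Type*) [CommRing R] :
    (n : ℕ) → (M : Type*) → [AddCommGroup M] → [Module R M] → Prop
  | 0, M, _, _ => Module.Projective R M
  | (n+1), M, _, _ => ∃ (P : Type _) (_ : AddCommGroup P) (_ : Module R P)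
      (f : P →ₗ[R] M), Module.Projective R P ∧ Function.Surjective f ∧
        pdimLE R n (LinearMap.ker f)

/-- The projective dimension of `S/I` over `S`: the length of a minimal (projective/free)
resolution, i.e. the least `n` such that `S/I` has a projective resolution of length `n`. -/
noncomputable def pdimQuot {K : Type*} [Field K] {V : Type*}
    (I : Ideal (MvPolynomial V K)) : ℕ :=
  sInf {n : ℕ | pdimLE (MvPolynomial V K) n (MvPolynomial V K ⧸ I)}

/-- The ladder graph `A n` on `2n` vertices: `inl i = x_{i+1}`, `inr i = y_{i+1}`. -/
def graphA (n : ℕ) : SimpleGraph (Fin n ⊕ Fin n) :=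
  SimpleGraph.fromRel (fun a b =>
    match a, b with
    | .inl i, .inl j => (i : ℕ) + 1 = j
    | .inr i, .inr j => (i : ℕ) + 1 = j
    | .inl i, .inr j => (i : ℕ) = (j : ℕ)
    | .inr _, .inl _ => False)

/-- The graph `B n`: the ladder `A n` with one extra vertex `y_{n+1}` and edge `{y_n, y_{n+1}}`.
Here `inl i = x_{i+1}` (`i < n`) and `inr i = y_{i+1}` (`i < n+1`). -/
def graphB (n : ℕ) : SimpleGraph (Fin n ⊕ Fin (n+1)) :=
  SimpleGraph.fromRel (fun a b =>
    match a, b with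
    | .inl i, .inl j => (i : ℕ) + 1 = j
    | .inr i, .inr j => (i : ℕ) + 1 = j
    | .inl i, .inr j => (i : ℕ) = (j : ℕ)
    | .inr _, .inl _ => False)

/-- The graph `C n`: the ladder `A n` with two extra vertices `y_{n+1}, y_{n+2}` and extra
edges `{y_n, y_{n+1}}` and `{y_1, y_{n+2}}`. Here `inl i = x_{i+1}` (`i < n`) and
`inr i = y_{i+1}` (`i < n+2`). -/
def graphC (n : ℕ) : SimpleGraph (Fin n ⊕ Fin (n+2)) :=
  SimpleGraph.fromRel (fun a b =>
    match a, b with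
    | .inl i, .inl j => (i : ℕ) + 1 = j
    | .inr i, .inr j => ((i : ℕ) + 1 = j ∧ (j : ℕ) ≤ n) ∨ ((i : ℕ) = 0 ∧ (j : ℕ) = n + 1)
    | .inl i, .inr j => (i : ℕ) = (j : ℕ)
    | .inr _, .inl _ => False)

/-- The graph `D n`: the ladder `A n` with two extra vertices `x_{n+1}, y_{n+1}` and extra
edges `{y_n, y_{n+1}}` and `{x_1, x_{n+1}}`. Here `inl i = x_{i+1}` and `inr i = y_{i+1}`
(`i < n+1`). -/
def graphD (n : ℕ) : SimpleGraph (Fin (n+1) ⊕ Fin (n+1)) :=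
  SimpleGraph.fromRel (fun a b =>
    match a, b with
    | .inl i, .inl j => ((i : ℕ) + 1 = j ∧ (j : ℕ) ≤ n - 1) ∨ ((i : ℕ) = 0 ∧ (j : ℕ) = n)
    | .inr i, .inr j => (i : ℕ) + 1 = j
    | .inl i, .inr j => (i : ℕ) = (j : ℕ) ∧ (i : ℕ) ≤ n - 1
    | .inr _, .inl _ => False)

/-- The circulant graph `C_q(s)` on vertex set `{x_1, …, x_q}` (realized as `Fin q`):
`x_i` and `x_j` are adjacent iff `|i - j| ∈ s` or `q - |i - j| ∈ s`. -/
def circulantGraph (q : ℕ) (s : Set ℕ) : SimpleGraph (Fin q) :=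
  SimpleGraph.fromRel (fun i j =>
    ((i : ℤ) - (j : ℤ)).natAbs ∈ s ∨ q - ((i : ℤ) - (j : ℤ)).natAbs ∈ s)



section Algebra

open CategoryTheory Abelian

universe u

/-! ### Comparison of `pdimLE` with Mathlib's projective dimension -/

theorem pdimLE_iff_hasPD {R : Type u} [CommRing R] (n : ℕ) :
    ∀ (M : Type u) [AddCommGroup M] [Module R M],
      pdimLE R n M ↔ HasProjectiveDimensionLT (ModuleCat.of R M) (n + 1) := by
  induction n with
  | zero =>
    intro M _ _
    rw [zero_add, ← projective_iff_hasProjectiveDimensionLT_one]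
    exact IsProjective.iff_projective M
  | succ n ih =>
    intro M _ _
    constructor
    · rintro ⟨P, _, _, f, hP, hf, hk⟩
      have hS := LinearMap.shortExact_shortComplexKer hf
      have hP' : Projective (ModuleCat.of R P) := (IsProjective.iff_projective P).1 hP
      exact (hS.hasProjectiveDimensionLT_X₃_iff n hP').2 ((ih _).1 hk)
    · intro h
      refine ⟨M →₀ R, inferInstance, inferInstance,
        Finsupp.linearCombination R (id : M → M), inferInstance,
        Finsupp.linearCombination_id_surjective R M, ?_⟩
      have hS := LinearMap.shortExact_shortComplexKer
        (Finsupp.linearCombination_id_surjective R M)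
      have hP' : Projective (ModuleCat.of R (M →₀ R)) :=
        (IsProjective.iff_projective _).1 inferInstance
      exact (ih _).2 ((hS.hasProjectiveDimensionLT_X₃_iff n hP').1 h)

/-! ### The ideals `I(G) + (A)` -/

variable {K : Type u} [Field K] {V : Type}

/-- The ideal generated by the edge ideal of `G` and the variables in `A`. -/
noncomputable def edgeVarIdeal (K : Type u) [Field K] (G : SimpleGraph V) (A : Set V) :
    Ideal (MvPolynomial V K) :=
  edgeIdeal K G ⊔ Ideal.span (X '' A)

theorem mem_edgeVarIdeal (G : SimpleGraph V) (A : Set V) (f : MvPolynomial V K) :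
    f ∈ edgeVarIdeal K G A ↔ ∀ m ∈ f.support,
      (∃ a ∈ A, m a ≠ 0) ∨ ∃ a b, G.Adj a b ∧ m a ≠ 0 ∧ m b ≠ 0 := by
  classical
  have h : edgeVarIdeal K G A = Ideal.span ((fun s => monomial s (1 : K)) ''
      ({s | ∃ a b, G.Adj a b ∧ s = Finsupp.single a 1 + Finsupp.single b 1} ∪
        {s | ∃ a ∈ A, s = Finsupp.single a 1})) := by
    rw [edgeVarIdeal, edgeIdeal, ← Ideal.span_union, Set.image_union]
    congr 1
    congr 1
    · ext p
      constructor
      · rintro ⟨i, j, hij, rfl⟩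
        exact ⟨_, ⟨i, j, hij, rfl⟩, by simp [X, monomial_mul]⟩
      · rintro ⟨_, ⟨i, j, hij, rfl⟩, rfl⟩
        exact ⟨i, j, hij, by simp [X, monomial_mul]⟩
    · ext p
      constructor
      · rintro ⟨i, hi, rfl⟩
        exact ⟨_, ⟨i, hi, rfl⟩, rfl⟩
      · rintro ⟨_, ⟨i, hi, rfl⟩, rfl⟩
        exact ⟨i, hi, rfl⟩
  rw [h, mem_ideal_span_monomial_image]
  refine forall₂_congr fun m _ => ?_
  constructor
  · rintro ⟨s, (⟨a, b, hab, rfl⟩ | ⟨a, ha, rfl⟩), hs⟩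
    · right
      refine ⟨a, b, hab, ?_, ?_⟩
      · have := hs a
        simp at this
        omega
      · have := hs b
        simp at this
        omega
    · left
      refine ⟨a, ha, ?_⟩
      have := hs a
      simp at this
      omega
  · rintro (⟨a, ha, hm⟩ | ⟨a, b, hab, hma, hmb⟩)
    · refine ⟨_, Or.inr ⟨a, ha, rfl⟩, ?_⟩
      rw [Finsupp.single_le_iff]
      omega
    · refine ⟨_, Or.inl ⟨a, b, hab, rfl⟩, ?_⟩
      intro c
      have := hab.ne
      simp only [Finsupp.add_apply, Finsupp.single_apply]
      split_ifs <;> subst_vars <;> first | omega | simp_all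

/-- Multiplication by `x` as a map `S/J₁ → S/J₂`. -/
noncomputable def mulQuot {R : Type u} [CommRing R] (J₁ J₂ : Ideal R) (x : R)
    (h : ∀ f ∈ J₁, x * f ∈ J₂) : (R ⧸ J₁) →ₗ[R] (R ⧸ J₂) :=
  Submodule.mapQ J₁ J₂ (LinearMap.lsmul R R x) (fun f hf => h f hf)

theorem mulQuot_mk {R : Type u} [CommRing R] (J₁ J₂ : Ideal R) (x : R)
    (h : ∀ f ∈ J₁, x * f ∈ J₂) (f : R) :
    mulQuot J₁ J₂ x h (Submodule.Quotient.mk f) = Submodule.Quotient.mk (x * f) := rfl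

theorem quot_shortExact {R : Type u} [CommRing R] (J₁ J₂ J₃ : Ideal R) (x : R)
    (h₁ : ∀ f, f ∈ J₁ ↔ x * f ∈ J₂) (h₃ : J₃ = J₂ ⊔ Ideal.span {x}) :
    ∃ (h : (∀ f ∈ J₁, x * f ∈ J₂) ∧ (∀ f ∈ J₂, 1 * f ∈ J₃))
      (w : _), (ShortComplex.mk (ModuleCat.ofHom (mulQuot J₁ J₂ x h.1))
        (ModuleCat.ofHom (mulQuot J₂ J₃ 1 h.2)) w).ShortExact := by
  have hle : J₂ ≤ J₃ := h₃ ▸ le_sup_left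
  have hx : x ∈ J₃ := h₃ ▸ (le_sup_right : _ ≤ J₂ ⊔ Ideal.span {x}) (Ideal.mem_span_singleton_self x)
  refine ⟨⟨fun f hf => (h₁ f).1 hf, fun f hf => by simpa using hle hf⟩, ?_, ?_⟩
  · apply ModuleCat.hom_ext
    ext
    change (Submodule.Quotient.mk (1 * (x * 1)) : R ⧸ J₃) = 0
    rw [Submodule.Quotient.mk_eq_zero]
    simpa using hx
  · apply ModuleCat.shortComplex_shortExact
    · intro y
      obtain ⟨f, rfl⟩ := Submodule.Quotient.mk_surjective _ y
      change (Submodule.Quotient.mk (1 * f) : R ⧸ J₃) = 0 ↔ _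
      have hm : f ∈ J₃ ↔ ∃ a ∈ J₂, ∃ b ∈ Ideal.span {x}, a + b = f := by
        rw [h₃, Submodule.mem_sup]
      rw [Submodule.Quotient.mk_eq_zero, one_mul]
      refine hm.trans ?_
      constructor
      · rintro ⟨a, ha, b, hb, rfl⟩
        obtain ⟨c, rfl⟩ := Ideal.mem_span_singleton'.1 hb
        refine ⟨Submodule.Quotient.mk c, ?_⟩
        change (Submodule.Quotient.mk (x * c) : R ⧸ J₂) = _
        rw [Submodule.Quotient.eq]
        convert neg_mem ha using 1
        ring
      · rintro ⟨z, hz⟩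
        obtain ⟨c, rfl⟩ := Submodule.Quotient.mk_surjective _ z
        change (Submodule.Quotient.mk (x * c) : R ⧸ J₂) = _ at hz
        rw [Submodule.Quotient.eq] at hz
        exact ⟨_, neg_mem hz, x * c, Ideal.mem_span_singleton'.2 ⟨c, mul_comm _ _⟩, by ring⟩
    · rw [injective_iff_map_eq_zero]
      intro y hy
      obtain ⟨f, rfl⟩ := Submodule.Quotient.mk_surjective _ y
      change (Submodule.Quotient.mk (x * f) : R ⧸ J₂) = 0 at hy
      change (Submodule.Quotient.mk f : R ⧸ J₁) = 0
      rw [Submodule.Quotient.mk_eq_zero] at hy ⊢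
      exact (h₁ f).2 hy
    · intro y
      obtain ⟨f, rfl⟩ := Submodule.Quotient.mk_surjective _ y
      exact ⟨Submodule.Quotient.mk f, congrArg _ (one_mul f)⟩

theorem colon_edgeVarIdeal (G : SimpleGraph V) (A : Set V) (v : V) (hv : v ∉ A)
    (f : MvPolynomial V K) :
    f ∈ edgeVarIdeal K G (A ∪ G.neighborSet v) ↔ X v * f ∈ edgeVarIdeal K G A := by
  classical
  rw [mem_edgeVarIdeal, mem_edgeVarIdeal, support_X_mul]
  simp only [Finset.mem_map, addLeftEmbedding_apply, forall_exists_index, and_imp,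
    forall_apply_eq_imp_iff₂]
  refine forall₂_congr fun m _ => ?_
  simp only [Finsupp.add_apply, Finsupp.single_apply, Set.mem_union, SimpleGraph.mem_neighborSet]
  constructor
  · rintro (⟨a, ha | ha, hm⟩ | ⟨a, b, hab, hma, hmb⟩)
    · exact Or.inl ⟨a, ha, by omega⟩
    · exact Or.inr ⟨v, a, ha, by simp, by omega⟩
    · exact Or.inr ⟨a, b, hab, by omega, by omega⟩
  · rintro (⟨a, ha, hm⟩ | ⟨a, b, hab, hma, hmb⟩)
    · have : v ≠ a := fun h => hv (h ▸ ha)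
      exact Or.inl ⟨a, Or.inl ha, by simpa [this] using hm⟩
    · by_cases h1 : v = a
      · subst h1
        have := hab.ne
        exact Or.inl ⟨b, Or.inr hab, by simpa [this] using hmb⟩
      · by_cases h2 : v = b
        · subst h2
          exact Or.inl ⟨a, Or.inr hab.symm, by simpa [h1] using hma⟩
        · exact Or.inr ⟨a, b, hab, by simpa [h1] using hma, by simpa [h2] using hmb⟩

theorem insert_edgeVarIdeal (G : SimpleGraph V) (A : Set V) (v : V) :
    edgeVarIdeal K G (insert v A) = edgeVarIdeal K G A ⊔ Ideal.span {X v} := by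
  rw [edgeVarIdeal, edgeVarIdeal, Set.image_insert_eq, Ideal.span_insert, sup_assoc,
    sup_comm (Ideal.span {X v})]

/-- `S/(I(G)+(A))` has projective dimension at most `k`. -/
def PD (K : Type u) [Field K] (G : SimpleGraph V) (A : Set V) (k : ℕ) : Prop :=
  HasProjectiveDimensionLT
    (ModuleCat.of (MvPolynomial V K) (MvPolynomial V K ⧸ edgeVarIdeal K G A)) (k + 1)

theorem PD.mono {G : SimpleGraph V} {A : Set V} {k l : ℕ} (h : PD K G A k) (hkl : k ≤ l) :
    PD K G A l := by
  unfold PD at *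
  exact hasProjectiveDimensionLT_of_ge _ (k + 1) (l + 1) (by omega)

theorem PD.split {G : SimpleGraph V} {A : Set V} {k : ℕ} (v : V) (hv : v ∉ A)
    (h₁ : PD K G (A ∪ G.neighborSet v) k) (h₂ : PD K G (insert v A) k) : PD K G A k := by
  obtain ⟨h, w, hS⟩ := quot_shortExact (edgeVarIdeal K G (A ∪ G.neighborSet v))
    (edgeVarIdeal K G A) (edgeVarIdeal K G (insert v A)) (X v)
    (colon_edgeVarIdeal G A v hv) (insert_edgeVarIdeal G A v)
  exact hS.hasProjectiveDimensionLT_X₂ (k + 1) h₁ h₂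

theorem bot_shortExact (A : Set V) (v : V) (hv : v ∉ A) :
    ∃ (h : (∀ f ∈ edgeVarIdeal K ⊥ A, X v * f ∈ edgeVarIdeal K ⊥ A) ∧
        (∀ f ∈ edgeVarIdeal K ⊥ A, 1 * f ∈ edgeVarIdeal K ⊥ (insert v A)))
      (w : _), (ShortComplex.mk
        (ModuleCat.ofHom (mulQuot (edgeVarIdeal K ⊥ A) (edgeVarIdeal K ⊥ A) (X v) h.1))
        (ModuleCat.ofHom (mulQuot (edgeVarIdeal K ⊥ A) (edgeVarIdeal K ⊥ (insert v A)) 1 h.2))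
        w).ShortExact := by
  apply quot_shortExact
  · have := colon_edgeVarIdeal (K := K) ⊥ A v hv
    simpa [SimpleGraph.neighborSet] using this
  · exact insert_edgeVarIdeal ⊥ A v

theorem edgeVarIdeal_bot_empty : edgeVarIdeal K (⊥ : SimpleGraph V) ∅ = ⊥ := by
  simp [edgeVarIdeal, edgeIdeal]

theorem PD.bot [DecidableEq V] (A : Finset V) : PD K (⊥ : SimpleGraph V) (A : Set V) A.card := by
  induction A using Finset.induction_on with
  | empty =>
    rw [Finset.coe_empty, Finset.card_empty, PD, edgeVarIdeal_bot_empty,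
      ← pdimLE_iff_hasPD 0]
    exact Module.Projective.of_equiv (Submodule.quotEquivOfEqBot (⊥ : Ideal (MvPolynomial V K)) rfl).symm
  | insert v A hv ih =>
    rw [Finset.card_insert_of_notMem hv, Finset.coe_insert]
    obtain ⟨h, w, hS⟩ := bot_shortExact (K := K) (A : Set V) v (by simpa using hv)
    exact hS.hasProjectiveDimensionLT_X₃ (A.card + 1) ih (ih.mono (Nat.le_succ _))

theorem PD.leaf [DecidableEq V] (G : SimpleGraph V) (A : Finset V)
    (h : ∀ a b, G.Adj a b → a ∈ A ∨ b ∈ A) : PD K G (A : Set V) A.card := by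
  have : edgeVarIdeal K G (A : Set V) = edgeVarIdeal K ⊥ (A : Set V) := by
    ext f
    rw [mem_edgeVarIdeal, mem_edgeVarIdeal]
    refine forall₂_congr fun m _ => ?_
    constructor
    · rintro (h' | ⟨a, b, hab, hma, hmb⟩)
      · exact Or.inl h'
      · rcases h a b hab with ha | hb
        · exact Or.inl ⟨a, ha, hma⟩
        · exact Or.inl ⟨b, hb, hmb⟩
    · rintro (h' | ⟨a, b, hab, _⟩)
      · exact Or.inl h'
      · exact absurd hab (by simp)
  rw [PD, this]
  exact PD.bot A

/-! ### Lower bound -/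

theorem ext_smul_of_smul_eq {R : Type u} [CommRing R] {M N : ModuleCat.{u} R} (n : ℕ) (r c : R)
    (h : ∀ y : N, r • y = c • y) (x : Ext M N n) : r • x = c • x := by
  rw [Ext.smul_eq_comp_mk₀, Ext.smul_eq_comp_mk₀]
  congr 2
  ext y
  exact h y

theorem ext_bot_nontrivial [DecidableEq V] (N : ModuleCat.{u} (MvPolynomial V K)) [Nontrivial N]
    (A : Finset V) (hA : ∀ v ∈ A, ∀ y : N, (X v : MvPolynomial V K) • y = 0) :
    Nontrivial (Ext (ModuleCat.of (MvPolynomial V K)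
      (MvPolynomial V K ⧸ edgeVarIdeal K ⊥ (A : Set V))) N A.card) := by
  induction A using Finset.induction_on with
  | empty =>
    rw [Finset.coe_empty, Finset.card_empty, edgeVarIdeal_bot_empty]
    obtain ⟨y, hy⟩ := exists_ne (0 : N)
    let g : (MvPolynomial V K ⧸ (⊥ : Ideal (MvPolynomial V K))) →ₗ[MvPolynomial V K] N :=
      Submodule.liftQ ⊥ (LinearMap.toSpanSingleton _ N y) bot_le
    refine ⟨Ext.mk₀ (ModuleCat.ofHom g), 0, ?_⟩
    rw [← Ext.mk₀_zero, (Ext.mk₀_bijective _ _).1.ne_iff]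
    intro h0
    apply hy
    have h1 : g (Submodule.Quotient.mk 1) = 0 := by
      have := congrArg (fun t => t.hom (Submodule.Quotient.mk 1)) h0
      simpa using! this
    have h2 : g (Submodule.Quotient.mk 1) = (1 : MvPolynomial V K) • y := rfl
    rw [h1, one_smul] at h2
    exact h2.symm
  | insert v A hv ih =>
    rw [Finset.card_insert_of_notMem hv, Finset.coe_insert]
    obtain ⟨h, w, hS⟩ := bot_shortExact (K := K) (A : Set V) v (by simpa using hv)
    have := ih (fun v hv => hA v (Finset.mem_insert_of_mem hv))
    obtain ⟨x, hx⟩ := exists_ne (0 : Ext (ModuleCat.of (MvPolynomial V K)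
      (MvPolynomial V K ⧸ edgeVarIdeal K ⊥ (A : Set V))) N A.card)
    refine ⟨hS.extClass.comp x (add_comm 1 _), 0, fun h0 => hx ?_⟩
    obtain ⟨x₂, rfl⟩ := Ext.contravariant_sequence_exact₁ hS N x _ h0
    have e : (ModuleCat.ofHom (mulQuot (edgeVarIdeal K ⊥ (A : Set V))
        (edgeVarIdeal K ⊥ (A : Set V)) (X v) h.1)) =
        (X v : MvPolynomial V K) • 𝟙 (ModuleCat.of (MvPolynomial V K)
          (MvPolynomial V K ⧸ edgeVarIdeal K ⊥ (A : Set V))) := by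
      ext
      rfl
    change (Ext.mk₀ (ModuleCat.ofHom (mulQuot (edgeVarIdeal K ⊥ (A : Set V))
        (edgeVarIdeal K ⊥ (A : Set V)) (X v) h.1))).comp x₂ _ = 0
    rw [e, Ext.mk₀_smul, Ext.smul_comp, Ext.mk₀_id_comp,
      ext_smul_of_smul_eq _ _ 0 (fun y => by
        rw [hA v (Finset.mem_insert_self _ _) y, zero_smul]), zero_smul]

theorem PD.lower [DecidableEq V] (G : SimpleGraph V) (A M : Finset V)
    (hAM : ∀ v, v ∈ A ↔ v ∉ M)
    (hind : ∀ a b, G.Adj a b → a ∈ A ∨ b ∈ A) (hdom : ∀ a ∈ A, ∃ b ∈ M, G.Adj a b) (k : ℕ)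
    (h : PD K G ∅ k) : A.card ≤ k := by
  by_contra hk
  push Not at hk
  let ev : MvPolynomial V K →+* K := eval (fun v => if v ∈ M then (1 : K) else 0)
  let Q : Ideal (MvPolynomial V K) := RingHom.ker ev
  let N : ModuleCat.{u} (MvPolynomial V K) :=
    ModuleCat.of (MvPolynomial V K) (MvPolynomial V K ⧸ Q)
  have hQ : Q ≠ ⊤ := RingHom.ker_ne_top ev
  have : Nontrivial N := Ideal.Quotient.nontrivial_iff.2 hQ
  have hact : ∀ r c : MvPolynomial V K, ev r = ev c → ∀ y : N, r • y = c • y := by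
    intro r c hrc y
    obtain ⟨f, rfl⟩ := Submodule.Quotient.mk_surjective _ y
    change (Submodule.Quotient.mk (r * f) : MvPolynomial V K ⧸ Q) = Submodule.Quotient.mk (c * f)
    rw [Submodule.Quotient.eq, RingHom.mem_ker]
    simp [hrc]
  have hA : ∀ v ∈ A, ∀ y : N, (X v : MvPolynomial V K) • y = 0 := by
    intro v hv y
    rw [hact (X v) 0 (by simp [ev, (hAM v).1 hv]), zero_smul]
  have hnt := ext_bot_nontrivial N A hA
  obtain ⟨x, hx⟩ := exists_ne (0 : Ext (ModuleCat.of (MvPolynomial V K)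
    (MvPolynomial V K ⧸ edgeVarIdeal K ⊥ (A : Set V))) N A.card)
  let u : MvPolynomial V K := ∏ v ∈ M, X v
  have hu : ev u = ev 1 := by
    simp only [u, ev, map_prod, eval_X, map_one]
    exact Finset.prod_eq_one fun v hv => by simp [hv]
  have hle : ∀ f ∈ edgeVarIdeal K G ∅, 1 * f ∈ edgeVarIdeal K ⊥ (A : Set V) := by
    intro f hf
    rw [one_mul, mem_edgeVarIdeal]
    rw [mem_edgeVarIdeal] at hf
    intro m hm
    rcases hf m hm with ⟨a, ha, _⟩ | ⟨a, b, hab, hma, hmb⟩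
    · exact absurd ha (by simp)
    · rcases hind a b hab with ha | hb
      · exact Or.inl ⟨a, ha, hma⟩
      · exact Or.inl ⟨b, hb, hmb⟩
  have hmul : ∀ f ∈ edgeVarIdeal K ⊥ (A : Set V), u * f ∈ edgeVarIdeal K G ∅ := by
    have : edgeVarIdeal K ⊥ (A : Set V) ≤
        Submodule.comap (LinearMap.lsmul (MvPolynomial V K) (MvPolynomial V K) u)
          (edgeVarIdeal K G ∅) := by
      have hz : edgeIdeal K (⊥ : SimpleGraph V) = ⊥ := by simp [edgeIdeal]
      rw [edgeVarIdeal, hz, bot_sup_eq, Ideal.span, Submodule.span_le]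
      rintro _ ⟨a, ha, rfl⟩
      obtain ⟨b, hb, hab⟩ := hdom a ha
      change u * X a ∈ edgeVarIdeal K G ∅
      have hub : u = X b * ∏ v ∈ M.erase b, X v := (Finset.mul_prod_erase M _ hb).symm
      have : u * X a = (∏ v ∈ M.erase b, X v) * (X a * X b) := by rw [hub]; ring
      rw [this]
      exact Ideal.mul_mem_left _ _ (Ideal.mem_sup_left (Ideal.subset_span ⟨a, b, hab, rfl⟩))
    exact fun f hf => this hf
  let p := ModuleCat.ofHom (mulQuot _ _ (1 : MvPolynomial V K) hle)
  let q := ModuleCat.ofHom (mulQuot _ _ u hmul)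
  have hqp : q ≫ p = u • 𝟙 _ := by
    ext
    change (Submodule.Quotient.mk (1 * (u * 1)) : MvPolynomial V K ⧸ edgeVarIdeal K ⊥ (A : Set V))
      = Submodule.Quotient.mk (u * 1)
    rw [one_mul]
  have hsub := HasProjectiveDimensionLT.subsingleton (hX := h) _ (k + 1) A.card (by omega) N
  have h0 : (Ext.mk₀ p).comp x (zero_add _) = 0 := Subsingleton.elim _ _
  apply hx
  have h1 : (Ext.mk₀ q).comp ((Ext.mk₀ p).comp x (zero_add _)) (zero_add _) = x := by
    rw [Ext.mk₀_comp_mk₀_assoc, hqp, Ext.mk₀_smul, Ext.smul_comp, Ext.mk₀_id_comp,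
      ext_smul_of_smul_eq _ u 1 (hact u 1 hu), one_smul]
  rw [← h1, h0, Ext.comp_zero]

theorem pdimQuot_eq {G : SimpleGraph V} {k : ℕ} (h₁ : PD K G ∅ k)
    (h₂ : ∀ l, PD K G ∅ l → k ≤ l) : pdimQuot (edgeIdeal K G) = k := by
  have e : edgeVarIdeal K G ∅ = edgeIdeal K G := by simp [edgeVarIdeal]
  have hs : ∀ l, l ∈ {n : ℕ | pdimLE (MvPolynomial V K) n (MvPolynomial V K ⧸ edgeIdeal K G)} ↔
      PD K G ∅ l := by
    intro l
    rw [Set.mem_ofPred_eq, pdimLE_iff_hasPD, PD, e]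
  unfold pdimQuot
  apply le_antisymm
  · exact Nat.sInf_le ((hs k).2 h₁)
  · exact h₂ _ ((hs _).1 (Nat.sInf_mem ⟨k, (hs k).2 h₁⟩))

end Algebra

section Combinatorics

universe u

/-- A coordinate system identifying `G` with the induced subgraph of the infinite ladder on
`(0, x)`, the columns `1, …, n`, and `(n+1, y)`; row `x` is `true`, row `y` is `false`. -/
structure LadderCoord {V : Type} (G : SimpleGraph V) (n : ℕ) (col : V → ℕ) (row : V → Bool) :
    Prop where
  inj : ∀ v w, col v = col w → row v = row w → v = w
  adj : ∀ v w, G.Adj v w ↔ (col v = col w ∧ row v ≠ row w) ∨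
    (row v = row w ∧ (col v + 1 = col w ∨ col w + 1 = col v))
  dom : ∀ v, (col v = 0 ∧ row v = true) ∨ (1 ≤ col v ∧ col v ≤ n) ∨
    (col v = n + 1 ∧ row v = false)
  ex : ∀ i r, ((i = 0 ∧ r = true) ∨ (1 ≤ i ∧ i ≤ n) ∨ (i = n + 1 ∧ r = false)) →
    ∃ v, col v = i ∧ row v = r

/-- The bound for the live part with `m` full columns: `r = true` when the left pendant is in
row `x` (the row opposite to the right pendant). -/
def excess (m : ℕ) (r : Bool) : ℕ :=
  if r then 2 * m - 2 * (m / 4) else 2 * m + 1 - 2 * ((m + 2) / 4)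

theorem eq_of_ne_bnot : ∀ {a b : Bool}, (a ≠ !b) → a = b := by decide

theorem eq_bnot_of_ne : ∀ {a b : Bool}, a ≠ b → a = !b := by decide

variable {V : Type} [Fintype V] [DecidableEq V]

/-- The set `A` has killed everything to the left of column `j`, up to isolated vertices, and the
live part is the vertex `(j, r)` with everything to the right of column `j`. -/
structure LiveState (G : SimpleGraph V) (col : V → ℕ) (row : V → Bool)
    (A : Finset V) (j : ℕ) (r : Bool) : Prop where
  at_r : ∀ v, col v = j → row v = r → v ∉ A
  at_nr : ∀ v, col v = j → row v ≠ r → v ∈ A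
  right : ∀ v, j < col v → v ∉ A
  left : ∀ v w, col v < j → v ∉ A → G.Adj v w → w ∈ A

open Classical in
theorem PD_live {G : SimpleGraph V} {n : ℕ} {col : V → ℕ} {row : V → Bool}
    (hc : LadderCoord G n col row) (K : Type u) [Field K] (m : ℕ) :
    ∀ (j : ℕ) (r : Bool) (A : Finset V), j + m = n → (j = 0 → r = true) →
      LiveState G col row A j r → PD K G (A : Set V) (A.card + excess m r) := by
  induction m using Nat.strong_induction_on with
  | _ m ih =>
  intro j r A hjm hj0 hA
  obtain ⟨a1, a2, a3, a4⟩ := hA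
  by_cases hm0 : m = 0 ∧ r = true
  · obtain ⟨rfl, rfl⟩ := hm0
    refine (PD.leaf G A ?_).mono (by omega)
    intro a b hab
    by_contra hcon
    push Not at hcon
    obtain ⟨ha, hb⟩ := hcon
    have hba := hab.symm
    have d1 := hc.dom a
    have d2 := hc.dom b
    have := (hc.adj a b).1 hab
    have := a4 a b
    have := a4 b a
    have := a2 a
    have := a2 b
    grind
  -- the pivot
  obtain ⟨v, hvc, hvr⟩ := hc.ex (j + 1) r (by grind)
  obtain ⟨p, hpc, hpr⟩ := hc.ex j r (by grind)
  have hv : v ∉ A := a3 v (by omega)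
  have hcol : ∀ w, G.Adj v w → (col w = j ∧ row w = r) ∨ (col w = j + 1 ∧ row w ≠ r) ∨
      (col w = j + 2 ∧ row w = r) := by
    intro w hw
    have := (hc.adj v w).1 hw
    grind
  -- deleting the pivot
  have hdel : PD K G (insert v (A : Set V)) (A.card + excess m r) := by
    rw [← Finset.coe_insert]
    have hcard : (insert v A).card = A.card + 1 := Finset.card_insert_of_notMem hv
    rcases Nat.eq_zero_or_pos m with rfl | hm
    · have hr : r = false := by grind
      subst hr
      refine (PD.leaf G _ ?_).mono (by rw [hcard]; simp [excess])
      intro a b hab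
      by_contra hcon
      push Not at hcon
      obtain ⟨ha, hb⟩ := hcon
      have hba := hab.symm
      have d1 := hc.dom a
      have d2 := hc.dom b
      have := (hc.adj a b).1 hab
      have := a4 a b
      have := a4 b a
      have := a2 a
      have := a2 b
      have := hc.inj v a
      have := hc.inj v b
      grind
    · refine (ih (m - 1) (by omega) (j + 1) (!r) (insert v A) (by omega) (by omega) ?_).mono ?_
      · refine ⟨?_, ?_, ?_, ?_⟩
        · intro w h1 h2
          have := a3 w (by omega)
          grind
        · intro w h1 h2
          have h2' := eq_of_ne_bnot h2
          have := hc.inj v w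
          grind
        · intro w h1
          have := a3 w (by omega)
          grind
        · intro w z h1 h2 h3
          have h4 : w ∉ A := fun h => h2 (Finset.mem_insert_of_mem h)
          by_cases h5 : col w < j
          · exact Finset.mem_insert_of_mem (a4 w z h5 h4 h3)
          · have h6 : col w = j := by omega
            have h7 : row w = r := by
              by_contra h7
              exact h4 (a2 w h6 h7)
            have := (hc.adj w z).1 h3
            have := a4 z w
            have := a2 z
            have := hc.inj v z
            have := h3.symm
            grind
      · rw [hcard]
        unfold excess
        cases r <;> simp <;> omega
  -- choosing the pivot
  have hch : PD K G ((A : Set V) ∪ G.neighborSet v) (A.card + excess m r) := by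
    let B : Finset V := Finset.univ.filter (fun w => G.Adj v w)
    have hB : ∀ w, w ∈ B ↔ G.Adj v w := by simp [B]
    have hBs : ((A : Set V) ∪ G.neighborSet v) = ((A ∪ B : Finset V) : Set V) := by
      ext w
      simp [hB]
    rw [hBs]
    have hcardB : ∀ T : Finset (ℕ × Bool), (∀ w ∈ B, (col w, row w) ∈ T) → B.card ≤ T.card := by
      intro T hT
      refine Finset.card_le_card_of_injOn (fun w => (col w, row w)) hT ?_
      intro w _ z _ h
      simp only [Prod.mk.injEq] at h
      exact hc.inj w z h.1 h.2
    have hAB := Finset.card_union_le A B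
    have hleaf : ∀ w, w ∉ A ∪ B → col w ≤ j + 1 → ∀ z, G.Adj w z → z ∈ A ∪ B := by
      intro w h2 h1 z h3
      rw [Finset.mem_union, hB] at h2 ⊢
      push Not at h2
      obtain ⟨h2, h2'⟩ := h2
      by_cases h5 : col w < j
      · exact Or.inl (a4 w z h5 h2 h3)
      · have := (hc.adj v w)
        have := hc.inj v w
        have := a2 w
        have h6 : w = v := by grind
        subst h6
        exact Or.inr h3
    by_cases hm : m ≤ 1
    · have hBc : B.card ≤ excess m r := by
        rcases Nat.eq_zero_or_pos m with rfl | hm'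
        · refine (hcardB {(j, r)} ?_).trans (by simp [excess]; grind)
          intro w hw
          have := hcol w ((hB w).1 hw)
          have := hc.dom w
          simp only [Finset.mem_singleton, Prod.mk.injEq]
          grind
        · obtain rfl : m = 1 := by omega
          cases r
          · refine (hcardB {(j, false), (j + 1, true), (j + 2, false)} ?_).trans ?_
            · intro w hw
              have := hcol w ((hB w).1 hw)
              simp only [Finset.mem_insert, Finset.mem_singleton, Prod.mk.injEq]
              grind
            · exact Finset.card_le_three.trans (by simp [excess])
          · refine (hcardB {(j, true), (j + 1, false)} ?_).trans ?_
            · intro w hw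
              have := hcol w ((hB w).1 hw)
              have := hc.dom w
              simp only [Finset.mem_insert, Finset.mem_singleton, Prod.mk.injEq]
              grind
            · exact Finset.card_le_two.trans (by simp [excess])
      refine (PD.leaf G (A ∪ B) ?_).mono (by omega)
      intro a b hab
      by_contra hcon
      push Not at hcon
      obtain ⟨ha, hb⟩ := hcon
      have h1 : ¬ col a ≤ j + 1 := fun h => hb (hleaf a ha h b hab)
      have h2 : ¬ col b ≤ j + 1 := fun h => ha (hleaf b hb h a hab.symm)
      have := (hc.adj a b).1 hab
      have := hc.dom a
      have := hc.dom b
      grind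
    · have hBc : B.card ≤ 3 := by
        refine (hcardB {(j, r), (j + 1, !r), (j + 2, r)} ?_).trans Finset.card_le_three
        intro w hw
        simp only [Finset.mem_insert, Finset.mem_singleton, Prod.mk.injEq]
        rcases hcol w ((hB w).1 hw) with h | h | h
        · exact Or.inl h
        · exact Or.inr (Or.inl ⟨h.1, eq_bnot_of_ne h.2⟩)
        · exact Or.inr (Or.inr h)
      refine (ih (m - 2) (by omega) (j + 2) (!r) (A ∪ B) (by omega) (by omega) ?_).mono ?_
      · refine ⟨?_, ?_, ?_, ?_⟩
        · intro w h1 h2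
          have := a3 w (by omega)
          have := hcol w
          have := hB w
          grind
        · intro w h1 h2
          have h2' := eq_of_ne_bnot h2
          have := hc.adj v w
          have := hB w
          grind
        · intro w h1
          have := a3 w (by omega)
          have := hcol w
          have := hB w
          grind
        · intro w z h1 h2 h3
          exact hleaf w h2 (by omega) z h3
      · have : excess (m - 2) (!r) + 3 ≤ excess m r := by
          unfold excess
          cases r <;> simp <;> omega
        omega
  exact PD.split v (by simpa using hv) hch hdel

theorem PD_lower {G : SimpleGraph V} {n : ℕ} {col : V → ℕ} {row : V → Bool}
    (hc : LadderCoord G n col row) (hcard : Fintype.card V = 2 * n + 2)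
    (K : Type u) [Field K] (k : ℕ) (h : PD K G ∅ k) : 2 * n - 2 * (n / 4) ≤ k := by
  obtain ⟨o, ho⟩ : ∃ o : ℕ, (n % 4 ≤ 1 ∧ o = 0) ∨ (2 ≤ n % 4 ∧ o = 1) :=
    ⟨if n % 4 ≤ 1 then 0 else 1, by split_ifs <;> omega⟩
  let P : V → Prop := fun v => ((col v % 4 = o ∧ row v = true) ∨
    (col v % 4 = o + 2 ∧ row v = false)) ∨ (n % 4 = 0 ∧ col v = n + 1)
  classical
  let M : Finset V := Finset.univ.filter P
  have hM : ∀ v, v ∈ M ↔ P v := by simp [M]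
  have hlow := PD.lower (K := K) G Mᶜ M (by simp) ?_ ?_ k h
  · have hMc : M.card ≤ (Finset.range (2 * (n / 4) + 2)).card := by
      refine Finset.card_le_card_of_injOn (fun v => (col v + 1 - o) / 2) ?_ ?_
      · intro v hv
        have hv' := (hM v).1 hv
        have := hc.dom v
        simp only [Finset.coe_range, Set.mem_Iio]
        grind
      · intro v hv w hw hvw
        have hv' := (hM v).1 hv
        have hw' := (hM w).1 hw
        have := hc.dom v
        have := hc.dom w
        have := hc.inj v w
        simp only at hvw
        grind
    rw [Finset.card_range] at hMc
    have := Finset.card_compl M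
    omega
  · intro a b hab
    by_contra hcon
    simp only [Finset.mem_compl, not_or, not_not, hM] at hcon
    obtain ⟨ha, hb⟩ := hcon
    have := (hc.adj a b).1 hab
    have := hc.dom a
    have := hc.dom b
    grind
  · intro a ha
    simp only [Finset.mem_compl, hM] at ha
    have hd := hc.dom a
    have key : ∃ i r, ((i = 0 ∧ r = true) ∨ (1 ≤ i ∧ i ≤ n) ∨ (i = n + 1 ∧ r = false)) ∧
        (((i % 4 = o ∧ r = true) ∨ (i % 4 = o + 2 ∧ r = false)) ∨ (n % 4 = 0 ∧ i = n + 1)) ∧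
        ((col a = i ∧ row a ≠ r) ∨ (row a = r ∧ (col a + 1 = i ∨ i + 1 = col a))) := by
      by_cases h1 : col a % 2 = o
      · refine ⟨col a, !(row a), ?_, ?_, ?_⟩ <;> grind
      · by_cases h2 : ((col a + 1) % 4 = o ∧ row a = true) ∨
            ((col a + 1) % 4 = o + 2 ∧ row a = false)
        · refine ⟨col a + 1, row a, ?_, ?_, ?_⟩ <;> grind
        · refine ⟨col a - 1, row a, ?_, ?_, ?_⟩ <;> grind
    obtain ⟨i, r, h1, h2, h3⟩ := key
    obtain ⟨b, rfl, rfl⟩ := hc.ex i r h1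
    exact ⟨b, (hM b).2 h2, (hc.adj a b).2 h3⟩

/-- Column of a vertex of `graphD n`. -/
def colD (n : ℕ) : Fin (n + 1) ⊕ Fin (n + 1) → ℕ
  | .inl i => if (i : ℕ) = n then 0 else i + 1
  | .inr i => i + 1

/-- Row of a vertex of `graphD n`. -/
def rowD (n : ℕ) : Fin (n + 1) ⊕ Fin (n + 1) → Bool
  | .inl _ => true
  | .inr _ => false

theorem ladderCoord_graphD (n : ℕ) (hn : 2 ≤ n) :
    LadderCoord (graphD n) n (colD n) (rowD n) where
  inj := by
    rintro (⟨i, hi⟩ | ⟨i, hi⟩) (⟨j, hj⟩ | ⟨j, hj⟩) h1 h2 <;>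
      simp [colD, rowD] at h1 h2 ⊢
    · split_ifs at h1 <;> omega
    · exact h1
  adj := by
    rintro (⟨i, hi⟩ | ⟨i, hi⟩) (⟨j, hj⟩ | ⟨j, hj⟩) <;>
      simp [colD, rowD, graphD, SimpleGraph.fromRel_adj] <;> grind
  dom := by
    rintro (⟨i, hi⟩ | ⟨i, hi⟩) <;> simp [colD, rowD] <;> (try split_ifs) <;> omega
  ex := by
    intro i r h
    cases r
    · have hi : 1 ≤ i ∧ i ≤ n + 1 := by
        simp at h
        omega
      exact ⟨.inr ⟨i - 1, by omega⟩, by simp [colD]; omega, rfl⟩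
    · have hi : i ≤ n := by
        simp at h
        omega
      rcases Nat.eq_zero_or_pos i with rfl | h0
      · exact ⟨.inl ⟨n, by omega⟩, by simp [colD], rfl⟩
      · refine ⟨.inl ⟨i - 1, by omega⟩, ?_, rfl⟩
        simp only [colD]
        rw [if_neg (by omega)]
        omega

theorem pdimQuot_graphD (n : ℕ) (hn : 2 ≤ n) (K : Type u) [Field K] :
    pdimQuot (edgeIdeal K (graphD n)) = 2 * n - 2 * (n / 4) := by
  have hc := ladderCoord_graphD n hn
  apply pdimQuot_eq
  · have h := PD_live hc K n 0 true ∅ (by omega) (fun _ => rfl)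
      ⟨by simp, ?_, by simp, by omega⟩
    · simpa [excess] using h
    · intro v h1 h2
      have := hc.dom v
      grind
  · intro l hl
    exact PD_lower hc (by simp; omega) K l hl

end Combinatorics

theorem pdim_graphD (n : ℕ) (hn : 2 ≤ n) (K : Type*) [Field K] :
    ((n % 4 = 0 ∨ n % 4 = 1) → pdimQuot (edgeIdeal K (graphD n)) = 2 * n - ⌈((n : ℚ) + 1) / 2⌉₊ + 1) ∧
    ((n % 4 = 2 ∨ n % 4 = 3) → pdimQuot (edgeIdeal K (graphD n)) = 2 * n - ⌈((n : ℚ) + 1) / 2⌉₊ + 2) := by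
  have h := pdimQuot_graphD n hn K
  have hceil : ⌈((n : ℚ) + 1) / 2⌉₊ = (n + 2) / 2 := by
    rw [Nat.ceil_eq_iff (by omega)]
    have h1 : 2 * ((n + 2) / 2) ≤ n + 2 := by omega
    have h2 : n + 1 ≤ 2 * ((n + 2) / 2) := by omega
    have h1' : 2 * (((n + 2) / 2 : ℕ) : ℚ) ≤ (n : ℚ) + 2 := by exact_mod_cast h1
    have h2' : (n : ℚ) + 1 ≤ 2 * (((n + 2) / 2 : ℕ) : ℚ) := by exact_mod_cast h2
    have h3 : (((n + 2) / 2 - 1 : ℕ) : ℚ) = (((n + 2) / 2 : ℕ) : ℚ) - 1 := by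
      rw [Nat.cast_sub (by omega), Nat.cast_one]
    rw [h3]
    constructor <;> linarith
  rw [h, hceil]
  constructor <;> intro h4 <;> omega
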